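/- Advection identity for the shear energy: let ρ > 0, u = (u_k) and A = (A_{ij}) be smooth fields on an open subset of ℝ³, let c_s ≥ 0 be a constant, and set G := AᵀA, G̊ := dev G, E₃ := (1/4) c_s² ρ G̊:G̊ and α_{ij} := ρ c_s² A_{il} G̊_{lj}. Then at every point: (1/4) c_s² (G̊:G̊) ∂_k(ρ u_k) + α_{ij} u_k ∂_k A_{ij} = ∂_k( E₃ u_k ), i.e. ∂_ρ E₃ · ∂_k(ρ u_k) + ∂_{A_{ij}} E₃ · u_k ∂_k A_{ij} = ∂_k( E₃ u_k ), where Einstein summation over repeated indices in {1,2,3} is used. -/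

import Mathlib

/-!
Advection identity for the shear energy of the GPR model.
-/

noncomputable section

open scoped BigOperators

/-- A spatial point of ℝ³. -/
abbrev Pt : Type := Fin 3 → ℝ

/-- Partial derivative in the `k`-th coordinate direction. -/
def pd (k : Fin 3) (f : Pt → ℝ) (x : Pt) : ℝ :=
  fderiv ℝ f x (Pi.single k 1 : Fin 3 → ℝ)

/-- Trace-free (deviatoric) part of a 3×3 matrix. -/
def dev (M : Fin 3 → Fin 3 → ℝ) (i k : Fin 3) : ℝ :=
  M i k - (1 / 3) * (∑ m, M m m) * (if i = k then (1 : ℝ) else 0)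

/-- Metric tensor `G = AᵀA` of a matrix field, at a point. -/
def Gm (A : Fin 3 → Fin 3 → Pt → ℝ) (x : Pt) (i k : Fin 3) : ℝ :=
  ∑ j, A j i x * A j k x

/-- Shear energy density `E₃ = ¼ c_s² ρ G̊:G̊`. -/
def E3 (cs : ℝ) (ρ : Pt → ℝ) (A : Fin 3 → Fin 3 → Pt → ℝ) (x : Pt) : ℝ :=
  (1 / 4) * cs ^ 2 * ρ x * ∑ i, ∑ j, dev (Gm A x) i j * dev (Gm A x) i j

theorem pd_mul {k : Fin 3} {f g : Pt → ℝ} {x : Pt}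
    (hf : DifferentiableAt ℝ f x) (hg : DifferentiableAt ℝ g x) :
    pd k (fun y => f y * g y) x = pd k f x * g x + f x * pd k g x := by
  unfold pd
  rw [fderiv_fun_mul hf hg]
  simp only [add_apply, smul_apply, smul_eq_mul]
  ring

theorem pd_const_mul {k : Fin 3} {f : Pt → ℝ} {x : Pt} (c : ℝ) (hf : DifferentiableAt ℝ f x) :
    pd k (fun y => c * f y) x = c * pd k f x := by
  unfold pd
  rw [fderiv_const_mul hf]
  rfl

theorem pd_sum {k : Fin 3} {F : Fin 3 → Pt → ℝ} {x : Pt}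
    (hF : ∀ i, DifferentiableAt ℝ (F i) x) :
    pd k (fun y => ∑ i, F i y) x = ∑ i, pd k (F i) x := by
  unfold pd
  rw [fderiv_fun_sum fun i _ => hF i, sum_apply]

theorem pd_sub {k : Fin 3} {f g : Pt → ℝ} {x : Pt}
    (hf : DifferentiableAt ℝ f x) (hg : DifferentiableAt ℝ g x) :
    pd k (fun y => f y - g y) x = pd k f x - pd k g x := by
  unfold pd
  rw [fderiv_fun_sub hf hg]
  rfl

/-- Contracting with a trace-free matrix only sees the trace-free part. -/
theorem dev_contract_dev (M N : Fin 3 → Fin 3 → ℝ) :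
    ∑ i, ∑ j, dev M i j * dev N i j = ∑ i, ∑ j, dev M i j * N i j := by
  simp [dev, Fin.sum_univ_three]
  ring

theorem dev_symm {M : Fin 3 → Fin 3 → ℝ} (hM : ∀ i j, M i j = M j i) (i j : Fin 3) :
    dev M i j = dev M j i := by
  simp only [dev, hM i j, eq_comm]

theorem Gm_symm (A : Fin 3 → Fin 3 → Pt → ℝ) (x : Pt) (i j : Fin 3) :
    Gm A x i j = Gm A x j i := by
  simp only [Gm, mul_comm]

/-- For symmetric `S`, one has `S : (BᵀA + AᵀB) = 2 (A S) : B`. -/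
theorem symm_contract_gram {S : Fin 3 → Fin 3 → ℝ} (hS : ∀ i j, S i j = S j i)
    (A B : Fin 3 → Fin 3 → ℝ) :
    ∑ i, ∑ j, S i j * ∑ m, (B m i * A m j + A m i * B m j) =
      2 * ∑ i, ∑ j, (∑ l, A i l * S l j) * B i j := by
  simp only [Fin.sum_univ_three, hS 1 0, hS 2 0, hS 2 1]
  ring

section Fields

variable {A : Fin 3 → Fin 3 → Pt → ℝ} {x : Pt}

theorem differentiableAt_Gm (hA : ∀ i j, DifferentiableAt ℝ (A i j) x) (i j : Fin 3) :
    DifferentiableAt ℝ (fun y => Gm A y i j) x :=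
  DifferentiableAt.fun_sum fun m _ => (hA m i).fun_mul (hA m j)

theorem pd_Gm (hA : ∀ i j, DifferentiableAt ℝ (A i j) x) (k i j : Fin 3) :
    pd k (fun y => Gm A y i j) x =
      ∑ m, (pd k (A m i) x * A m j x + A m i x * pd k (A m j) x) := by
  unfold Gm
  rw [pd_sum fun m => (hA m i).fun_mul (hA m j)]
  exact Finset.sum_congr rfl fun m _ => pd_mul (hA m i) (hA m j)

theorem dev_Gm_eq (i j : Fin 3) :
    (fun y => dev (Gm A y) i j) = fun y =>
      Gm A y i j - (1 / 3 * if i = j then (1 : ℝ) else 0) * ∑ m, Gm A y m m := by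
  funext y
  simp only [dev]
  ring

theorem differentiableAt_dev_Gm (hA : ∀ i j, DifferentiableAt ℝ (A i j) x) (i j : Fin 3) :
    DifferentiableAt ℝ (fun y => dev (Gm A y) i j) x := by
  rw [dev_Gm_eq]
  exact (differentiableAt_Gm hA i j).fun_sub
    ((DifferentiableAt.fun_sum fun m _ => differentiableAt_Gm hA m m).const_mul _)

theorem pd_dev_Gm (hA : ∀ i j, DifferentiableAt ℝ (A i j) x) (k i j : Fin 3) :
    pd k (fun y => dev (Gm A y) i j) x =
      dev (fun a b => pd k (fun y => Gm A y a b) x) i j := by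
  rw [dev_Gm_eq, pd_sub (differentiableAt_Gm hA i j)
    ((DifferentiableAt.fun_sum fun m _ => differentiableAt_Gm hA m m).const_mul _),
    pd_const_mul _ (DifferentiableAt.fun_sum fun m _ => differentiableAt_Gm hA m m),
    pd_sum fun m => differentiableAt_Gm hA m m]
  simp only [dev]
  ring

theorem differentiableAt_dev_Gm_contract (hA : ∀ i j, DifferentiableAt ℝ (A i j) x) :
    DifferentiableAt ℝ (fun y => ∑ i, ∑ j, dev (Gm A y) i j * dev (Gm A y) i j) x :=
  DifferentiableAt.fun_sum fun i _ => DifferentiableAt.fun_sum fun j _ =>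
    (differentiableAt_dev_Gm hA i j).fun_mul (differentiableAt_dev_Gm hA i j)

/-- The chain rule `∂_k (G̊ : G̊) = 4 (A G̊) : ∂_k A`. -/
theorem pd_dev_Gm_contract (hA : ∀ i j, DifferentiableAt ℝ (A i j) x) (k : Fin 3) :
    pd k (fun y => ∑ i, ∑ j, dev (Gm A y) i j * dev (Gm A y) i j) x =
      4 * ∑ i, ∑ j, (∑ l, A i l x * dev (Gm A x) l j) * pd k (A i j) x := by
  have hG := differentiableAt_dev_Gm hA
  have h : pd k (fun y => ∑ i, ∑ j, dev (Gm A y) i j * dev (Gm A y) i j) x =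
      2 * ∑ i, ∑ j, dev (Gm A x) i j * dev (fun a b => pd k (fun y => Gm A y a b) x) i j := by
    rw [pd_sum fun i => DifferentiableAt.fun_sum fun j _ => (hG i j).fun_mul (hG i j),
      Finset.mul_sum]
    refine Finset.sum_congr rfl fun i _ => ?_
    rw [pd_sum fun j => (hG i j).fun_mul (hG i j), Finset.mul_sum]
    refine Finset.sum_congr rfl fun j _ => ?_
    rw [pd_mul (hG i j) (hG i j), pd_dev_Gm hA]
    ring
  rw [h, dev_contract_dev]
  simp only [pd_Gm hA]
  rw [symm_contract_gram (dev_symm (Gm_symm A x)) (fun i j => A i j x)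
    (fun i j => pd k (A i j) x)]
  ring

end Fields

/-- **Advection identity for the shear energy.**  For smooth fields `ρ > 0`,
`u`, `A` on an open subset of ℝ³, with `α_{ij} = ρ c_s² A_{il} G̊_{lj}`:
`∂_ρE₃ ∂_k(ρu_k) + ∂_{A_{ij}}E₃ u_k ∂_k A_{ij} = ∂_k(E₃ u_k)`. -/
theorem shear_energy_advection_identity
    (Ω : Set Pt) (hΩ : IsOpen Ω)
    (cs : ℝ) (hcs : 0 ≤ cs)
    (ρ : Pt → ℝ) (u : Fin 3 → Pt → ℝ) (A : Fin 3 → Fin 3 → Pt → ℝ)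
    (hρ : ContDiffOn ℝ (⊤ : ℕ∞) ρ Ω) (hρpos : ∀ x ∈ Ω, 0 < ρ x)
    (hu : ∀ k, ContDiffOn ℝ (⊤ : ℕ∞) (u k) Ω)
    (hA : ∀ i j, ContDiffOn ℝ (⊤ : ℕ∞) (A i j) Ω) :
    ∀ x ∈ Ω,
      -- (1/4) c_s² (G̊:G̊) ∂_k(ρ u_k)
      ((1 / 4) * cs ^ 2 * (∑ i, ∑ j, dev (Gm A x) i j * dev (Gm A x) i j)) *
          (∑ k, pd k (fun y => ρ y * u k y) x)
        -- + α_{ij} u_k ∂_k A_{ij}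
        + (∑ i, ∑ j, (ρ x * cs ^ 2 * ∑ l, A i l x * dev (Gm A x) l j) *
            (∑ k, u k x * pd k (A i j) x))
      =
      -- ∂_k(E₃ u_k)
      ∑ k, pd k (fun y => E3 cs ρ A y * u k y) x := by
  intro x hx
  have hΩx := hΩ.mem_nhds hx
  have hρ' : DifferentiableAt ℝ ρ x := (hρ.contDiffAt hΩx).differentiableAt (by simp)
  have hu' k : DifferentiableAt ℝ (u k) x := ((hu k).contDiffAt hΩx).differentiableAt (by simp)
  have hA' i j : DifferentiableAt ℝ (A i j) x :=
    ((hA i j).contDiffAt hΩx).differentiableAt (by simp)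
  have key k : pd k (fun y => E3 cs ρ A y * u k y) x =
      ((1 / 4) * cs ^ 2 * (∑ i, ∑ j, dev (Gm A x) i j * dev (Gm A x) i j)) *
          pd k (fun y => ρ y * u k y) x
        + ∑ i, ∑ j, (ρ x * cs ^ 2 * ∑ l, A i l x * dev (Gm A x) l j) *
            (u k x * pd k (A i j) x) := by
    have hE : (fun y => E3 cs ρ A y * u k y) = fun y => (1 / 4) * cs ^ 2 *
        ((ρ y * u k y) * ∑ i, ∑ j, dev (Gm A y) i j * dev (Gm A y) i j) := by
      funext y
      simp only [E3]
      ring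
    have hρu := hρ'.fun_mul (hu' k)
    have hS := differentiableAt_dev_Gm_contract hA'
    have hα : ∑ i, ∑ j, (ρ x * cs ^ 2 * ∑ l, A i l x * dev (Gm A x) l j) *
        (u k x * pd k (A i j) x) = ρ x * cs ^ 2 * u k x *
          ∑ i, ∑ j, (∑ l, A i l x * dev (Gm A x) l j) * pd k (A i j) x := by
      simp only [Finset.mul_sum, Finset.sum_mul]
      refine Finset.sum_congr rfl fun i _ => Finset.sum_congr rfl fun j _ => Finset.sum_congr rfl fun l _ => ?_
      ring
    rw [hE, pd_const_mul _ (hρu.fun_mul hS), pd_mul hρu hS, pd_dev_Gm_contract hA', hα]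
    ring
  rw [Finset.sum_congr rfl fun k _ => key k, Finset.sum_add_distrib, ← Finset.mul_sum]
  congr 1
  rw [eq_comm, Finset.sum_comm]
  refine Finset.sum_congr rfl fun i _ => ?_
  rw [Finset.sum_comm]
  exact Finset.sum_congr rfl fun j _ => (Finset.mul_sum ..).symm
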